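/- Let C ∈ W be a Coxeter element, and define ⟨x,y⟩ = ((1−C)^{-1}x, y) on V (which makes sense since 1−C is invertible). Then for all roots α, β ∈ R the value ⟨α,β⟩ is an integer. -/

import Mathlib

open RealInnerProductSpace

variable {V : Type*} [NormedAddCommGroup V] [InnerProductSpace ℝ V] [FiniteDimensional ℝ V]

/-- The reflection in the hyperplane orthogonal to a vector `α` with `⟪α, α⟫ = 2`,
as a linear map: `x ↦ x - ⟪α, x⟫ α`. -/
noncomputable def reflLM (α : V) : V →ₗ[ℝ] V :=
  LinearMap.id - ((innerSL ℝ α).toLinearMap).smulRight α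

/-- `R` is an irreducible simply-laced (crystallographic, with all roots of squared
length 2) finite root system spanning `V`. -/
structure IsSimplyLacedRootSystem (R : Finset V) : Prop where
  zero_not_mem : (0 : V) ∉ R
  span_top : Submodule.span ℝ (R : Set V) = ⊤
  norm_two : ∀ α ∈ R, ⟪α, α⟫ = (2 : ℝ)
  inner_int : ∀ α ∈ R, ∀ β ∈ R, ∃ n : ℤ, ⟪α, β⟫ = (n : ℝ)
  reflect_mem : ∀ α ∈ R, ∀ β ∈ R, reflLM α β ∈ R
  irreducible : ∀ S ⊆ R, (∀ α ∈ S, ∀ β ∈ R, β ∉ S → ⟪α, β⟫ = 0) → S = ∅ ∨ S = R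

/-- `Δ` is a base (system of simple roots) of the root system `R`: it consists of
roots, it is a linearly independent spanning set, and every root is a nonnegative or
nonpositive integral combination of elements of `Δ`. -/
def IsBase (R : Finset V) (Δ : Set V) : Prop :=
  Δ ⊆ (R : Set V) ∧
  LinearIndependent ℝ (Subtype.val : Δ → V) ∧
  Submodule.span ℝ Δ = ⊤ ∧
  ∀ β ∈ R, β ∈ AddSubmonoid.closure Δ ∨ -β ∈ AddSubmonoid.closure Δ

/-- A Coxeter element of the Weyl group of `R`: a product of the simple reflections
with respect to some base of `R`, each occurring exactly once. -/
def IsCoxeterElement (R : Finset V) (C : V →ₗ[ℝ] V) : Prop :=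
  ∃ l : List V, l.Nodup ∧ IsBase R {x | x ∈ l} ∧ C = (l.map reflLM).prod

theorem reflLM_apply' (a x : V) : reflLM a x = x - ⟪a, x⟫ • a := by
  simp [reflLM]

/-- Being integral against every element of a set extends to its integral span. -/
theorem int_inner_of_span (S : Set V) (x : V) (h : ∀ a ∈ S, ∃ n : ℤ, ⟪a, x⟫ = (n : ℝ))
    (z : V) (hz : z ∈ Submodule.span ℤ S) : ∃ n : ℤ, ⟪z, x⟫ = (n : ℝ) := by
  induction hz using Submodule.span_induction with
  | mem a ha => exact h a ha
  | zero => exact ⟨0, by simp⟩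
  | add u v _ _ hu hv =>
    obtain ⟨m, hm⟩ := hu
    obtain ⟨n, hn⟩ := hv
    exact ⟨m + n, by rw [inner_add_left, hm, hn]; push_cast; rfl⟩
  | smul k u _ hu =>
    obtain ⟨m, hm⟩ := hu
    refine ⟨k * m, ?_⟩
    rw [← Int.cast_smul_eq_zsmul ℝ k u, real_inner_smul_left, hm]
    push_cast; rfl

/-- `x - s₁ ⋯ sₙ x` lies in the span of the roots involved. -/
theorem sub_prod_mem_span (l : List V) (x : V) :
    x - (l.map reflLM).prod x ∈ Submodule.span ℝ {y | y ∈ l} := by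
  induction l with
  | nil => simp
  | cons a l ih =>
    have hs : ({y | y ∈ a :: l} : Set V) = insert a {y | y ∈ l} := by
      ext y; simp
    rw [hs, List.map_cons, List.prod_cons, Module.End.mul_apply, reflLM_apply',
      Submodule.mem_span_insert]
    exact ⟨_, _, ih, by abel⟩

theorem key (l : List V) (hn : l.Nodup)
    (hli : LinearIndepOn ℝ id ({y | y ∈ l} : Set V))
    (hint : ∀ a ∈ l, ∀ b ∈ l, ∃ n : ℤ, ⟪a, b⟫ = (n : ℝ)) (x : V)
    (hx : x - (l.map reflLM).prod x ∈ Submodule.span ℤ ({y | y ∈ l} : Set V)) :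
    ∀ a ∈ l, ∃ n : ℤ, ⟪a, x⟫ = (n : ℝ) := by
  induction l with
  | nil => simp
  | cons a l ih =>
    have hs : ({y | y ∈ a :: l} : Set V) = insert a {y | y ∈ l} := by
      ext y; simp
    rw [List.nodup_cons] at hn
    rw [hs] at hli
    rw [hs, List.map_cons, List.prod_cons, Module.End.mul_apply, reflLM_apply',
      Submodule.mem_span_insert] at hx
    obtain ⟨m, z, hz, hx⟩ := hx
    have hna : a ∉ Submodule.span ℝ ({y | y ∈ l} : Set V) :=
      ((linearIndepOn_id_insert (by simpa using hn.1)).1 hli).2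
    have hz' : z ∈ Submodule.span ℝ ({y | y ∈ l} : Set V) :=
      Submodule.span_subset_span ℤ ℝ _ hz
    have hmem := sub_prod_mem_span l x
    generalize (l.map reflLM).prod x = w at *
    rw [← Int.cast_smul_eq_zsmul ℝ m a] at hx
    have he : ((m : ℝ) - ⟪a, w⟫) • a = (x - w) - z := by
      rw [sub_smul, eq_sub_iff_add_eq]
      have : x - w = ((m : ℝ) • a + z) - ⟪a, w⟫ • a := by rw [← hx]; abel
      rw [this]; abel
    have ht : (m : ℝ) - ⟪a, w⟫ = 0 := by
      by_contra hne
      apply hna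
      rw [← Submodule.smul_mem_iff _ hne, he]
      exact Submodule.sub_mem _ hmem hz'
    have hxz : x - w = z := by
      rw [ht, zero_smul] at he
      exact (sub_eq_zero.1 he.symm)
    intro b hb
    rcases List.mem_cons.1 hb with rfl | hb
    · obtain ⟨k, hk⟩ := int_inner_of_span _ b
        (fun c hc => hint c (List.mem_cons_of_mem _ hc) b (by simp)) z hz
      refine ⟨m + k, ?_⟩
      have : x = w + z := by rw [← hxz]; abel
      rw [this, inner_add_right, real_inner_comm z b, hk]
      push_cast
      linarith
    · exact ih hn.2 (hli.mono (Set.subset_insert _ _))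
        (fun c hc d hd => hint c (List.mem_cons_of_mem _ hc) d (List.mem_cons_of_mem _ hd))
        (by rw [hxz]; exact hz) b hb

/-- if `C` is a Coxeter element and `D = (1 - C)⁻¹` (which exists since
`1 - C` is invertible), then for all roots `α, β ∈ R` the value
`⟨α, β⟩ = ((1 - C)⁻¹ α, β)` is an integer. -/
theorem coxeter_form_integral_on_roots
    (R : Finset V) (hR : IsSimplyLacedRootSystem R)
    (C : V →ₗ[ℝ] V) (hC : IsCoxeterElement R C)
    (D : V →ₗ[ℝ] V) (hD₁ : D * ((1 : V →ₗ[ℝ] V) - C) = 1)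
    (hD₂ : ((1 : V →ₗ[ℝ] V) - C) * D = 1) :
    ∀ α ∈ R, ∀ β ∈ R, ∃ n : ℤ, ⟪D α, β⟫ = (n : ℝ) := by
  obtain ⟨l, hn, ⟨hsub, hli, -, hcl⟩, rfl⟩ := hC
  have hspan : ∀ β ∈ R, β ∈ Submodule.span ℤ ({y | y ∈ l} : Set V) := by
    have hc : ∀ β ∈ AddSubmonoid.closure ({y | y ∈ l} : Set V),
        β ∈ Submodule.span ℤ ({y | y ∈ l} : Set V) := by
      intro β hβ
      have : AddSubmonoid.closure ({y | y ∈ l} : Set V) ≤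
          (Submodule.span ℤ ({y | y ∈ l} : Set V)).toAddSubmonoid :=
        AddSubmonoid.closure_le.2 Submodule.subset_span
      exact this hβ
    intro β hβ
    rcases hcl β hβ with h | h
    · exact hc _ h
    · exact neg_mem_iff.1 (hc _ h)
  intro α hα β hβ
  have hx : D α - (l.map reflLM).prod (D α) = α := by
    simpa using LinearMap.congr_fun hD₂ α
  have hk := key l hn hli (fun a ha b hb => hR.inner_int a (hsub ha) b (hsub hb)) (D α)
    (by rw [hx]; exact hspan α hα)
  rw [real_inner_comm]
  exact int_inner_of_span _ (D α) hk β (hspan β hβ)
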